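/- Let T be a triangulated category and let M and N be objects of T. If there exist an object Z, a morphism u : Z → M and a nilpotent endomorphism v : Z → Z such that the morphism Z → M ⊕ Z with components u and v fits into a distinguished triangle Z → M ⊕ Z → N → Z[1], then there exist an object Z_r, a morphism u_r : M → Z_r and an endomorphism v_r : Z_r → Z_r (not asserted to be nilpotent) such that the morphism M ⊕ Z_r → Z_r with components u_r and v_r fits into a distinguished triangle N → M ⊕ Z_r → Z_r → N[1]. -/

import Mathlib

open CategoryTheory CategoryTheory.Limits CategoryTheory.Pretriangulated

namespace CategoryTheory

section Preadditive

open scoped ZeroObject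

variable {C : Type*} [Category C] [Preadditive C] [HasZeroObject C] [HasBinaryBiproducts C]

/-- For `u : Z ⟶ M` and `v : Z ⟶ Z`, the morphism `φ = (u, v ≫ u, …, v ^ (n - 1) ≫ u)` to `M ^ n`
is such that `(u, v ≫ φ)` agrees with `(v ^ n ≫ u, φ)` up to an automorphism of `M ⊞ M ^ n`. -/
lemma exists_iso_biprod_lift_pow {M Z : C} (u : Z ⟶ M) (v : End Z) (n : ℕ) :
    ∃ (P : C) (φ : Z ⟶ P) (e : M ⊞ P ≅ M ⊞ P),
      biprod.lift u ((v : Z ⟶ Z) ≫ φ) ≫ e.hom =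
        biprod.lift (((v ^ n : End Z) : Z ⟶ Z) ≫ u) φ := by
  induction n with
  | zero =>
    refine ⟨0, 0, Iso.refl _, ?_⟩
    simp [End.one_def]
  | succ n ih =>
    obtain ⟨P, φ, e, he⟩ := ih
    let swap : M ⊞ (M ⊞ P) ≅ M ⊞ (M ⊞ P) :=
      { hom := biprod.lift (biprod.snd ≫ biprod.fst)
          (biprod.lift biprod.fst (biprod.snd ≫ biprod.snd))
        inv := biprod.lift (biprod.snd ≫ biprod.fst)
          (biprod.lift biprod.fst (biprod.snd ≫ biprod.snd)) }
    refine ⟨M ⊞ P, biprod.lift u ((v : Z ⟶ Z) ≫ φ),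
      biprod.mapIso (Iso.refl M) e ≪≫ swap, ?_⟩
    have he₁ := he =≫ biprod.fst
    have he₂ := he =≫ biprod.snd
    simp only [Category.assoc, biprod.lift_fst, biprod.lift_snd] at he₁ he₂
    ext <;> simp [swap, he₁, he₂, pow_succ, End.mul_def]

end Preadditive

namespace Pretriangulated

open Triangulated

variable {C : Type*} [Category C] [Preadditive C] [HasZeroObject C] [HasShift C ℤ]
  [∀ n : ℤ, (CategoryTheory.shiftFunctor C n).Additive] [Pretriangulated C]

lemma distinguished_mk_of_iso {X Y Z X' Y' Z' : C} {f : X ⟶ Y} {g : Y ⟶ Z}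
    {h : Z ⟶ X⟦(1 : ℤ)⟧} {f' : X' ⟶ Y'} {g' : Y' ⟶ Z'} {h' : Z' ⟶ X'⟦(1 : ℤ)⟧}
    (H : Triangle.mk f g h ∈ distTriang C) (e₁ : X' ≅ X) (e₂ : Y' ≅ Y) (e₃ : Z' ≅ Z)
    (comm₁ : f' ≫ e₂.hom = e₁.hom ≫ f) (comm₂ : g' ≫ e₃.hom = e₂.hom ≫ g)
    (comm₃ : h' ≫ e₁.hom⟦(1 : ℤ)⟧' = e₃.hom ≫ h) :
    Triangle.mk f' g' h' ∈ distTriang C :=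
  isomorphic_distinguished _ H _ (Triangle.isoMk _ _ e₁ e₂ e₃ comm₁ comm₂ comm₃)

variable [IsTriangulated C]

/-- A cone of `𝟙 M ⊞ φ` is also a cone of `φ`. -/
lemma exists_distinguished_of_biprod_map_id (M : C) {Z P Q : C} (φ : Z ⟶ P)
    {g : M ⊞ P ⟶ Q} {δ : Q ⟶ (M ⊞ Z)⟦(1 : ℤ)⟧}
    (h : Triangle.mk (biprod.map (𝟙 M) φ) g δ ∈ distTriang C) :
    ∃ (g' : P ⟶ Q) (δ' : Q ⟶ Z⟦(1 : ℤ)⟧), Triangle.mk φ g' δ' ∈ distTriang C := by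
  have comm : (biprod.inl : M ⟶ M ⊞ Z) ≫ biprod.map (𝟙 M) φ = biprod.inl := by simp
  let o := someOctahedron comm (binaryBiproductTriangle_distinguished M Z) h
    (binaryBiproductTriangle_distinguished M P)
  have hm₁ : o.m₁ = φ := by
    rw [← cancel_epi (biprod.snd : M ⊞ Z ⟶ Z)]
    exact o.comm₁.trans (biprod.map_snd _ _)
  exact ⟨_, _, hm₁ ▸ o.mem⟩

/-- If `Q` is a cone of `φ : Z ⟶ P`, then `M ⊞ Q` is a cone of `(0, φ) : Z ⟶ M ⊞ P`. -/
lemma exists_distinguished_biprod_lift_zero (M : C) {Z P Q : C} {φ : Z ⟶ P}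
    {g : P ⟶ Q} {δ : Q ⟶ Z⟦(1 : ℤ)⟧} (h : Triangle.mk φ g δ ∈ distTriang C) :
    ∃ (g' : M ⊞ P ⟶ M ⊞ Q) (δ' : M ⊞ Q ⟶ Z⟦(1 : ℤ)⟧),
      Triangle.mk (biprod.lift (0 : Z ⟶ M) φ) g' δ' ∈ distTriang C := by
  obtain ⟨W, a, b, hW⟩ := distinguished_cocone_triangle (biprod.lift (0 : Z ⟶ M) φ)
  have hinr : Triangle.mk (biprod.inr : P ⟶ M ⊞ P) biprod.fst 0 ∈ distTriang C :=
    distinguished_mk_of_iso (binaryBiproductTriangle_distinguished P M)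
      (Iso.refl P) (biprod.braiding M P) (Iso.refl M)
      (by ext <;> simp) (by simp) (by simp)
  have comm : φ ≫ (biprod.inr : P ⟶ M ⊞ P) = biprod.lift 0 φ := by ext <;> simp
  let o := someOctahedron comm h hinr hW
  obtain ⟨e, -, -⟩ := exists_iso_binaryBiproduct_of_distTriang _ o.mem zero_comp
  let e' : W ≅ M ⊞ Q := e ≪≫ biprod.braiding Q M
  exact ⟨a ≫ e'.hom, e'.inv ≫ b, distinguished_mk_of_iso hW
    (Iso.refl _) (Iso.refl _) e'.symm (by simp) (by simp) (by simp)⟩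

end Pretriangulated

end CategoryTheory

/-- **Remark (general triangulated categories).** In any triangulated category, if there is a
distinguished triangle `Z ⟶ M ⊞ Z ⟶ N ⟶ Z⟦1⟧` whose first map has components `u : Z ⟶ M`
and a nilpotent `v : Z ⟶ Z`, then there is a distinguished triangle
`N ⟶ M ⊞ Z_r ⟶ Z_r ⟶ N⟦1⟧` whose middle map has components `u_r : M ⟶ Z_r` and some
endomorphism `v_r` of `Z_r` (not asserted to be nilpotent). -/
theorem right_degeneration_of_left_degeneration
    {T : Type*} [Category T] [Preadditive T] [HasZeroObject T]
    [HasShift T ℤ] [∀ n : ℤ, (CategoryTheory.shiftFunctor T n).Additive]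
    [Pretriangulated T] [IsTriangulated T]
    (M N : T)
    (h : ∃ (Z : T) (u : Z ⟶ M) (v : End Z)
        (g : M ⊞ Z ⟶ N) (δ : N ⟶ Z⟦(1 : ℤ)⟧),
        IsNilpotent v ∧
        Triangle.mk (biprod.lift u (v : Z ⟶ Z)) g δ ∈ distTriang T) :
    ∃ (Zr : T) (ur : M ⟶ Zr) (vr : Zr ⟶ Zr)
        (f : N ⟶ M ⊞ Zr) (δ : Zr ⟶ N⟦(1 : ℤ)⟧),
        Triangle.mk f (biprod.desc ur vr) δ ∈ distTriang T := by
  obtain ⟨Z, u, v, g, δ, ⟨n, hn⟩, hN⟩ := h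
  obtain ⟨P, φ, e, he⟩ := exists_iso_biprod_lift_pow u v n
  rw [hn, show ((0 : End Z) : Z ⟶ Z) ≫ u = 0 from zero_comp] at he
  obtain ⟨Q, a, b, hQ⟩ := distinguished_cocone_triangle (biprod.map (𝟙 M) φ)
  obtain ⟨g₁, δ₁, h₁⟩ := exists_distinguished_of_biprod_map_id M φ hQ
  obtain ⟨g₂, δ₂, h₂⟩ := exists_distinguished_biprod_lift_zero M h₁
  have h₃ : Triangle.mk (biprod.lift u ((v : Z ⟶ Z) ≫ φ)) (e.hom ≫ g₂) δ₂ ∈ distTriang T :=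
    distinguished_mk_of_iso h₂ (Iso.refl _) e (Iso.refl _)
      (by simpa using he) (by simp) (by simp)
  have comm : biprod.lift u (v : Z ⟶ Z) ≫ biprod.map (𝟙 M) φ =
      biprod.lift u ((v : Z ⟶ Z) ≫ φ) := by ext <;> simp
  let o := Triangulated.someOctahedron comm hN hQ h₃
  refine ⟨Q, biprod.inl ≫ o.m₃, biprod.inr ≫ o.m₃, o.m₁, b ≫ g⟦(1 : ℤ)⟧', ?_⟩
  rw [show biprod.desc (biprod.inl ≫ o.m₃) (biprod.inr ≫ o.m₃) = o.m₃ by ext <;> simp]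
  exact o.mem
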